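/- arXiv:2312.17665 — 2 statements merged into one kernel-verified Lean document; each statement's English description precedes it below -/
import Mathlib

section
/- There exists a constant c > 0, depending only on p, C0 and C1, such that for every ε ∈ [0,1], every μ > 0, every (C0,C1)-elliptic symmetric matrix γ and all ξ, ξ̃ ∈ ℝ^{nN} with |ξ|_γ ≥ 1 + μ/4, |ξ|_γ ≤ 1 + 2μ and |ξ̃|_γ ≤ 1 + 2μ, one has |ℬ_ε(γ,ξ)(ξ̃ − ξ, η) − ⟨A_ε(γ,ξ̃) − A_ε(γ,ξ), η⟩_γ| ≤ c μ^{p−3} |ξ̃ − ξ|² |η| for every η ∈ ℝ^{nN}. -/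
noncomputable section

open Real

/-- The `γ`-inner product on `ℝ^{nN}`. -/
def gInner {n N : ℕ} (γ : Matrix (Fin n) (Fin n) ℝ) (ξ η : Fin N → Fin n → ℝ) : ℝ :=
  ∑ i, ∑ α, ∑ β, γ α β * ξ i α * η i β

/-- The `γ`-norm on `ℝ^{nN}`. -/
def gNorm {n N : ℕ} (γ : Matrix (Fin n) (Fin n) ℝ) (ξ : Fin N → Fin n → ℝ) : ℝ :=
  Real.sqrt (gInner γ ξ ξ)

/-- The Euclidean norm on `ℝ^{nN}`. -/
def eNorm {n N : ℕ} (ξ : Fin N → Fin n → ℝ) : ℝ :=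
  Real.sqrt (∑ i, ∑ α, ξ i α ^ 2)

/-- A symmetric `(C0, C1)`-elliptic matrix. -/
def IsElliptic {n : ℕ} (C0 C1 : ℝ) (γ : Matrix (Fin n) (Fin n) ℝ) : Prop :=
  (∀ α β, γ α β = γ β α) ∧
  ∀ ζ : Fin n → ℝ,
    C0 * ∑ α, ζ α ^ 2 ≤ (∑ α, ∑ β, γ α β * ζ α * ζ β) ∧
    (∑ α, ∑ β, γ α β * ζ α * ζ β) ≤ C1 * ∑ α, ζ α ^ 2

/-- `h(t) = (t-1)_+^{p-1} / t` (with the convention `h(0) = 0`). -/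
def hfun (p t : ℝ) : ℝ := (max (t - 1) 0) ^ (p - 1) / t

/-- `g(t) = (t-1)_+^p / t`. -/
def gfun (p t : ℝ) : ℝ := (max (t - 1) 0) ^ p / t

/-- The derivative of `h` on `(1,∞)`, extended by `0` elsewhere. -/
def hderiv (p s : ℝ) : ℝ :=
  if 1 < s then (s - 1) ^ (p - 2) * ((p - 2) * s + 1) / s ^ 2 else 0

/-- The derivative of `g` on `(1,∞)`, extended by `0` elsewhere. -/
def gderiv (p s : ℝ) : ℝ :=
  if 1 < s then (s - 1) ^ (p - 1) * ((p - 1) * s + 1) / s ^ 2 else 0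

/-- `λ(t) = min{h(t), (p-1)(t-1)^{p-2}}` for `t > 1`, and `0` for `t ≤ 1`. -/
def lamFun (p t : ℝ) : ℝ :=
  if 1 < t then min (hfun p t) ((p - 1) * (t - 1) ^ (p - 2)) else 0

/-- `Λ(t) = max{h(t), (p-1)(t-1)^{p-2}}` for `t > 1`, and `0` for `t ≤ 1`. -/
def LamFun (p t : ℝ) : ℝ :=
  if 1 < t then max (hfun p t) ((p - 1) * (t - 1) ^ (p - 2)) else 0

/-- The vector field `A_ε(γ, ξ) = h_ε(|ξ|_γ) ξ` (equal to `0` at `ξ = 0`). -/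
def Avf {n N : ℕ} (p ε : ℝ) (γ : Matrix (Fin n) (Fin n) ℝ) (ξ : Fin N → Fin n → ℝ) :
    Fin N → Fin n → ℝ :=
  fun i α => (hfun p (gNorm γ ξ) + ε) * ξ i α

/-- The map `G_δ(γ, ξ) = ((|ξ|_γ - 1 - δ)_+ / |ξ|_γ) ξ` (equal to `0` at `ξ = 0`). -/
def Gmap {n N : ℕ} (δ : ℝ) (γ : Matrix (Fin n) (Fin n) ℝ) (ξ : Fin N → Fin n → ℝ) :
    Fin N → Fin n → ℝ :=
  fun i α => (max (gNorm γ ξ - 1 - δ) 0) / gNorm γ ξ * ξ i α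

/-- The bilinear form `𝒜_ε(γ, ξ)` on third-order tensors in `ℝ^{n²N}`. -/
def Aform {n N : ℕ} (p ε : ℝ) (γ : Matrix (Fin n) (Fin n) ℝ) (ξ : Fin N → Fin n → ℝ)
    (η ζ : Fin N → Fin n → Fin n → ℝ) : ℝ :=
  ∑ i, ∑ j, ∑ α, ∑ β, ∑ ν, ∑ σ,
    ((hfun p (gNorm γ ξ) + ε) * γ α β * (if i = j then (1 : ℝ) else 0) +
        hderiv p (gNorm γ ξ) / gNorm γ ξ *
          (∑ d, γ α d * ξ i d) * (∑ k, γ β k * ξ j k)) *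
      γ ν σ * η i α ν * ζ j β σ

/-- The bilinear form `ℬ_ε(γ, ξ)` on `ℝ^{nN}`. -/
def Bform {n N : ℕ} (p ε : ℝ) (γ : Matrix (Fin n) (Fin n) ℝ) (ξ : Fin N → Fin n → ℝ)
    (η ζ : Fin N → Fin n → ℝ) : ℝ :=
  ∑ i, ∑ j, ∑ α, ∑ β,
    ((hfun p (gNorm γ ξ) + ε) * γ α β * (if i = j then (1 : ℝ) else 0) +
        hderiv p (gNorm γ ξ) / gNorm γ ξ *
          (∑ d, γ α d * ξ i d) * (∑ k, γ β k * ξ j k)) *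
      η i α * ζ j β

/-- The bilinear form `𝒞_ε(γ, ξ)` on `ℝ^n`. -/
def Cform {n N : ℕ} (p ε : ℝ) (γ : Matrix (Fin n) (Fin n) ℝ) (ξ : Fin N → Fin n → ℝ)
    (ζ ζ' : Fin n → ℝ) : ℝ :=
  ∑ α, ∑ β,
    ((hfun p (gNorm γ ξ) + ε) * γ α β +
        hderiv p (gNorm γ ξ) / gNorm γ ξ *
          (∑ i, (∑ d, γ α d * ξ i d) * (∑ k, γ β k * ξ i k))) *
      ζ α * ζ' β

/-- The squared `γ`-norm of a third-order tensor in `ℝ^{n²N}`. -/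
def tNormSq {n N : ℕ} (γ : Matrix (Fin n) (Fin n) ℝ) (η : Fin N → Fin n → Fin n → ℝ) : ℝ :=
  ∑ i, ∑ α, ∑ β, ∑ ν, ∑ σ, γ α β * γ ν σ * η i α ν * η i β σ

/-- On a compact interval of positive reals a real power is bounded. -/
lemma exists_rpow_bound_Icc {l : ℝ} (hl : 0 < l) (r : ℝ) (u : ℝ) :
    ∃ K : ℝ, 0 ≤ K ∧ ∀ x ∈ Set.Icc l u, x ^ r ≤ K := by
  have hc : ContinuousOn (fun x : ℝ => x ^ r) (Set.Icc l u) := fun x hx =>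
    (Real.continuousAt_rpow_const x r (Or.inl (hl.trans_le hx.1).ne')).continuousWithinAt
  obtain ⟨K, hK⟩ := isCompact_Icc.exists_bound_of_continuousOn hc
  exact ⟨max K 0, le_max_right _ _, fun x hx =>
    (le_abs_self _).trans ((hK x hx).trans (le_max_left _ _))⟩

/-- Real powers are Lipschitz on compact intervals of positive reals. -/
lemma exists_rpow_lipschitz_Icc {l : ℝ} (hl : 0 < l) (r : ℝ) (u : ℝ) :
    ∃ K : ℝ, 0 ≤ K ∧ ∀ x ∈ Set.Icc l u, ∀ y ∈ Set.Icc l u,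
      |y ^ r - x ^ r| ≤ K * |y - x| := by
  obtain ⟨K, hK0, hK⟩ := exists_rpow_bound_Icc hl (r - 1) u
  refine ⟨|r| * K, by positivity, fun x hx y hy => ?_⟩
  refine Convex.norm_image_sub_le_of_norm_hasDerivWithin_le (f := fun x : ℝ => x ^ r)
    (f' := fun x => r * x ^ (r - 1)) (s := Set.Icc l u) (fun z hz => ?_) (fun z hz => ?_)
    (convex_Icc l u) hx hy
  · exact (Real.hasDerivAt_rpow_const (Or.inl (hl.trans_le hz.1).ne')).hasDerivWithinAt
  · have hz0 : 0 < z := hl.trans_le hz.1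
    rw [Real.norm_eq_abs, abs_mul, abs_of_pos (Real.rpow_pos_of_pos hz0 _)]
    exact mul_le_mul_of_nonneg_left (hK z hz) (abs_nonneg r)

/-- First-order Taylor expansion with quadratic remainder for real powers on compact intervals of
positive reals. -/
lemma exists_rpow_taylor_Icc {l : ℝ} (hl : 0 < l) (q : ℝ) (u : ℝ) :
    ∃ K : ℝ, 0 ≤ K ∧ ∀ a ∈ Set.Icc l u, ∀ b ∈ Set.Icc l u,
      |b ^ q - a ^ q - q * a ^ (q - 1) * (b - a)| ≤ K * (b - a) ^ 2 := by
  obtain ⟨K, hK0, hK⟩ := exists_rpow_lipschitz_Icc hl (q - 1) u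
  refine ⟨|q| * K, by positivity, fun a ha b hb => ?_⟩
  have hsub : Set.uIcc a b ⊆ Set.Icc l u := Set.uIcc_subset_Icc ha hb
  have h := Convex.norm_image_sub_le_of_norm_hasDerivWithin_le
    (f := fun x : ℝ => x ^ q - q * a ^ (q - 1) * x)
    (f' := fun x => q * x ^ (q - 1) - q * a ^ (q - 1) * 1) (s := Set.uIcc a b)
    (C := |q| * K * |b - a|) (fun z hz => ?_) (fun z hz => ?_)
    (convex_uIcc a b) Set.left_mem_uIcc Set.right_mem_uIcc
  · rw [Real.norm_eq_abs, Real.norm_eq_abs] at h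
    calc |b ^ q - a ^ q - q * a ^ (q - 1) * (b - a)|
        = |b ^ q - q * a ^ (q - 1) * b - (a ^ q - q * a ^ (q - 1) * a)| := by congr 1; ring
      _ ≤ |q| * K * |b - a| * |b - a| := h
      _ = |q| * K * (b - a) ^ 2 := by rw [← sq_abs (b - a)]; ring
  · have hz0 : z ≠ 0 := (hl.trans_le (hsub hz).1).ne'
    exact ((Real.hasDerivAt_rpow_const (Or.inl hz0)).sub
      ((hasDerivAt_id z).const_mul _)).hasDerivWithinAt
  · have hza : |z - a| ≤ |b - a| := Set.abs_sub_left_of_mem_uIcc hz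
    rw [Real.norm_eq_abs, show q * z ^ (q - 1) - q * a ^ (q - 1) * 1
      = q * (z ^ (q - 1) - a ^ (q - 1)) by ring, abs_mul, mul_assoc]
    have := hK a ha z (hsub hz)
    gcongr
    exact this.trans (by gcongr)

/-- Quadratic remainder for the positive part of a real power, away from the singularity of the
base point. -/
lemma exists_posPart_rpow_taylor {q : ℝ} (hq : 0 < q) :
    ∃ C : ℝ, 0 ≤ C ∧ ∀ a ∈ Set.Icc (1 / 4 : ℝ) 2, ∀ b ≤ (2 : ℝ),
      |(max b 0) ^ q - a ^ q - q * a ^ (q - 1) * (b - a)| ≤ C * (b - a) ^ 2 := by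
  obtain ⟨K, hK0, hK⟩ := exists_rpow_taylor_Icc (l := 1 / 8) (by norm_num) q 2
  obtain ⟨L, hL0, hL⟩ := exists_rpow_bound_Icc (l := 1 / 4) (by norm_num) (q - 1) 2
  have h2 : 0 < (2 : ℝ) ^ q := by positivity
  refine ⟨K + 64 * 2 ^ q + 64 * 2 ^ q + 8 * q * L, by positivity, fun a ha b hb => ?_⟩
  have ha0 : 0 < a := by linarith [ha.1]
  rcases le_or_gt (1 / 8) b with h | h
  · rw [max_eq_left (by linarith)]
    refine (hK a ⟨by linarith [ha.1], ha.2⟩ b ⟨h, hb⟩).trans ?_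
    gcongr
    have := mul_nonneg hq.le hL0
    linarith
  · have hd : 1 / 8 ≤ |b - a| := by
      rw [abs_sub_comm]
      exact le_trans (by linarith [ha.1]) (le_abs_self _)
    have hb1 : (max b 0) ^ q ≤ 2 ^ q :=
      Real.rpow_le_rpow (le_max_right _ _) (max_le hb (by norm_num)) hq.le
    have hb0 : 0 ≤ (max b 0) ^ q := by positivity
    have ha1 : a ^ q ≤ 2 ^ q := Real.rpow_le_rpow ha0.le ha.2 hq.le
    have haq : 0 ≤ a ^ q := by positivity
    have hr0 : 0 ≤ a ^ (q - 1) := by positivity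
    have hsq : 1 ≤ 64 * (b - a) ^ 2 := by rw [← sq_abs]; nlinarith
    have hlin : |b - a| ≤ 8 * (b - a) ^ 2 := by rw [← sq_abs]; nlinarith
    have h3 : |q * a ^ (q - 1) * (b - a)| ≤ q * L * (8 * (b - a) ^ 2) := by
      rw [abs_mul, abs_of_nonneg (by positivity)]
      have := hL a ha
      gcongr
    have h4 := mul_le_mul_of_nonneg_left hsq h2.le
    have h5 := mul_nonneg hK0 (sq_nonneg (b - a))
    rw [abs_le] at h3 ⊢
    constructor <;> nlinarith

section GammaInner

variable {n N : ℕ} {γ : Matrix (Fin n) (Fin n) ℝ}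

lemma gInner_add_left (u v w : Fin N → Fin n → ℝ) :
    gInner γ (u + v) w = gInner γ u w + gInner γ v w := by
  simp only [gInner, Pi.add_apply, mul_add, add_mul, Finset.sum_add_distrib]

lemma gInner_smul_left (c : ℝ) (u w : Fin N → Fin n → ℝ) :
    gInner γ (c • u) w = c * gInner γ u w := by
  simp only [gInner, Pi.smul_apply, smul_eq_mul, Finset.mul_sum]
  exact Finset.sum_congr rfl fun i _ => Finset.sum_congr rfl fun α _ =>
    Finset.sum_congr rfl fun β _ => by ring

lemma gInner_comm (hγ : ∀ α β, γ α β = γ β α) (u w : Fin N → Fin n → ℝ) :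
    gInner γ u w = gInner γ w u := by
  unfold gInner
  refine Finset.sum_congr rfl fun i _ => ?_
  rw [Finset.sum_comm]
  exact Finset.sum_congr rfl fun α _ => Finset.sum_congr rfl fun β _ => by rw [hγ β α]; ring

lemma gInner_self_nonneg {C0 C1 : ℝ} (hC0 : 0 < C0) (hγ : IsElliptic C0 C1 γ)
    (u : Fin N → Fin n → ℝ) : 0 ≤ gInner γ u u :=
  Finset.sum_nonneg fun i _ => le_trans (by positivity) (hγ.2 (u i)).1

lemma gNorm_sq {C0 C1 : ℝ} (hC0 : 0 < C0) (hγ : IsElliptic C0 C1 γ) (u : Fin N → Fin n → ℝ) :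
    gNorm γ u ^ 2 = gInner γ u u :=
  Real.sq_sqrt (gInner_self_nonneg hC0 hγ u)

lemma gNorm_nonneg (u : Fin N → Fin n → ℝ) : 0 ≤ gNorm γ u := Real.sqrt_nonneg _

lemma gNorm_le_sqrt_mul_eNorm {C0 C1 : ℝ} (hC1 : 0 ≤ C1) (hγ : IsElliptic C0 C1 γ)
    (u : Fin N → Fin n → ℝ) : gNorm γ u ≤ √C1 * eNorm u := by
  unfold gNorm eNorm
  rw [← Real.sqrt_mul hC1, Finset.mul_sum]
  exact Real.sqrt_le_sqrt (Finset.sum_le_sum fun i _ => (hγ.2 (u i)).2)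

/-- Cauchy–Schwarz inequality for the `γ`-inner product. -/
lemma abs_gInner_le {C0 C1 : ℝ} (hC0 : 0 < C0) (hγ : IsElliptic C0 C1 γ)
    (u w : Fin N → Fin n → ℝ) : |gInner γ u w| ≤ gNorm γ u * gNorm γ w := by
  have h := discrim_le_zero (a := gInner γ u u) (b := 2 * gInner γ u w) (c := gInner γ w w)
    fun x => by
      have h := gInner_self_nonneg hC0 hγ (x • u + w)
      rw [gInner_add_left, gInner_smul_left, gInner_comm hγ.1 u, gInner_comm hγ.1 w,
        gInner_add_left, gInner_add_left, gInner_smul_left, gInner_smul_left,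
        gInner_comm hγ.1 w u] at h
      linarith
  refine abs_le_of_sq_le_sq ?_ (mul_nonneg (gNorm_nonneg u) (gNorm_nonneg w))
  rw [mul_pow, gNorm_sq hC0 hγ, gNorm_sq hC0 hγ]
  unfold discrim at h
  linarith

lemma gInner_eq_sum_mul (hγ : ∀ α β, γ α β = γ β α) (ξ u : Fin N → Fin n → ℝ) :
    gInner γ ξ u = ∑ i, ∑ α, (∑ d, γ α d * ξ i d) * u i α := by
  rw [gInner_comm hγ]
  unfold gInner
  refine Finset.sum_congr rfl fun i _ => Finset.sum_congr rfl fun α _ => ?_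
  rw [Finset.sum_mul]
  exact Finset.sum_congr rfl fun β _ => by ring

lemma Bform_eq (p ε : ℝ) (hγ : ∀ α β, γ α β = γ β α) (ξ u w : Fin N → Fin n → ℝ) :
    Bform p ε γ ξ u w = (hfun p (gNorm γ ξ) + ε) * gInner γ u w +
      hderiv p (gNorm γ ξ) / gNorm γ ξ * (gInner γ ξ u * gInner γ ξ w) := by
  have hδ : ∑ i, ∑ j, ∑ α, ∑ β, γ α β * (if i = j then (1 : ℝ) else 0) * u i α * w j β =
      gInner γ u w := by
    refine Finset.sum_congr rfl fun i _ => ?_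
    rw [Finset.sum_eq_single i (fun j _ hj => by simp [hj.symm]) (by simp)]
    simp
  rw [gInner_eq_sum_mul hγ ξ u, gInner_eq_sum_mul hγ ξ w, ← hδ]
  unfold Bform
  generalize hfun p (gNorm γ ξ) + ε = x
  generalize hderiv p (gNorm γ ξ) / gNorm γ ξ = y
  generalize hX : (fun i α => ∑ d, γ α d * ξ i d) = X
  have hX' (i : Fin N) (α : Fin n) : ∑ d, γ α d * ξ i d = X i α := by rw [← hX]
  simp only [hX', Finset.sum_mul_sum]
  simp only [Finset.mul_sum, ← Finset.sum_add_distrib]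
  refine Finset.sum_congr rfl fun i _ => Finset.sum_congr rfl fun j _ =>
    Finset.sum_congr rfl fun α _ => Finset.sum_congr rfl fun β _ => ?_
  ring

end GammaInner

lemma mul_hfun (p : ℝ) {t : ℝ} (hp : 1 < p) (ht : 0 ≤ t) :
    t * hfun p t = (max (t - 1) 0) ^ (p - 1) := by
  unfold hfun
  rcases ht.eq_or_lt with rfl | ht
  · simp [Real.zero_rpow (sub_pos.2 hp).ne']
  · field_simp

lemma hderiv_eq (p : ℝ) {s : ℝ} (hs : 1 < s) :
    hderiv p s = (p - 1) * (s - 1) ^ (p - 2) / s - (s - 1) ^ (p - 1) / s ^ 2 := by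
  have hs0 : s ≠ 0 := by positivity
  rw [hderiv, if_pos hs, show p - 1 = p - 2 + 1 by ring, Real.rpow_add_one (by linarith)]
  field_simp
  ring

/-- Bound for `h'` and for the first-order Taylor remainder of `h`. -/
lemma exists_hderiv_and_remainder_bound {p : ℝ} (hp : 1 < p) :
    ∃ C : ℝ, 0 ≤ C ∧ ∀ μ s t : ℝ, 0 < μ → 1 + μ / 4 ≤ s → s ≤ 1 + 2 * μ → 0 ≤ t →
      t ≤ 1 + 2 * μ →
      |hderiv p s| ≤ C * μ ^ (p - 3) ∧
      |t * (hfun p t - hfun p s - hderiv p s * (t - s))| ≤ C * μ ^ (p - 3) * (t - s) ^ 2 := by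
  have hq : 0 < p - 1 := sub_pos.2 hp
  obtain ⟨C, hC0, hC⟩ := exists_posPart_rpow_taylor hq
  obtain ⟨K, hK0, hK⟩ := exists_rpow_bound_Icc (l := 1 / 4) (by norm_num) (p - 2) 2
  obtain ⟨L, hL0, hL⟩ := exists_rpow_bound_Icc (l := 1 / 4) (by norm_num) (p - 1) 2
  refine ⟨C + 4 * ((p - 1) * K) + 16 * L, by positivity, fun μ s t hμ hs1 hs2 ht0 ht => ?_⟩
  have hP : 0 < μ ^ (p - 3) := by positivity
  have hP1 : μ ^ (p - 2) = μ ^ (p - 3) * μ := by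
    rw [← Real.rpow_add_one hμ.ne']; congr 1; ring
  have hP2 : μ ^ (p - 1) = μ ^ (p - 3) * μ ^ 2 := by
    rw [show p - 1 = p - 2 + 1 by ring, Real.rpow_add_one hμ.ne', hP1]; ring
  have hs : 1 < s := by linarith
  have hs0 : 0 < s := by linarith
  obtain ⟨a, ha⟩ : ∃ a, s = 1 + μ * a := ⟨(s - 1) / μ, by field_simp; ring⟩
  obtain ⟨b, hb⟩ : ∃ b, t = 1 + μ * b := ⟨(t - 1) / μ, by field_simp; ring⟩
  have haI : a ∈ Set.Icc (1 / 4 : ℝ) 2 := by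
    constructor <;> by_contra! h <;> nlinarith
  have hb2 : b ≤ 2 := by by_contra! h; nlinarith
  have ha0 : 0 < a := by linarith [haI.1]
  have hx1 : (s - 1) ^ (p - 2) = μ ^ (p - 3) * μ * a ^ (p - 2) := by
    rw [ha, add_sub_cancel_left, Real.mul_rpow hμ.le ha0.le, hP1]
  have hx2 : (s - 1) ^ (p - 1) = μ ^ (p - 3) * μ ^ 2 * a ^ (p - 1) := by
    rw [ha, add_sub_cancel_left, Real.mul_rpow hμ.le ha0.le, hP2]
  have hy : (max (t - 1) 0) ^ (p - 1) = μ ^ (p - 3) * μ ^ 2 * (max b 0) ^ (p - 1) := by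
    rw [hb, add_sub_cancel_left, ← hP2, ← Real.mul_rpow hμ.le (le_max_right _ _),
      mul_max_of_nonneg _ _ hμ.le, mul_zero]
  have hμs : μ / s ≤ 4 := by rw [div_le_iff₀ hs0]; linarith
  have hμs0 : 0 ≤ μ / s := by positivity
  have hD1 : 0 ≤ (p - 1) * (s - 1) ^ (p - 2) / s := by
    have : 0 < s - 1 := by linarith
    positivity
  have hD2 : 0 ≤ (s - 1) ^ (p - 1) / s ^ 2 := by
    have : 0 < s - 1 := by linarith
    positivity
  have hD1' : (p - 1) * (s - 1) ^ (p - 2) / s ≤ 4 * ((p - 1) * K) * μ ^ (p - 3) := by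
    calc (p - 1) * (s - 1) ^ (p - 2) / s
        = (p - 1) * a ^ (p - 2) * (μ / s) * μ ^ (p - 3) := by rw [hx1]; ring
      _ ≤ (p - 1) * K * 4 * μ ^ (p - 3) := by
        have := hK a haI
        gcongr
      _ = _ := by ring
  have hD2' : (s - 1) ^ (p - 1) / s ^ 2 ≤ 16 * L * μ ^ (p - 3) := by
    calc (s - 1) ^ (p - 1) / s ^ 2 = a ^ (p - 1) * (μ / s) ^ 2 * μ ^ (p - 3) := by
          rw [hx2, div_pow]; ring
      _ ≤ L * 4 ^ 2 * μ ^ (p - 3) := by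
        have := hL a haI
        gcongr
      _ = _ := by ring
  have hCP : 0 ≤ C * μ ^ (p - 3) := by positivity
  constructor
  · rw [hderiv_eq p hs, abs_le]
    constructor <;> linarith
  · have hT : |(max (t - 1) 0) ^ (p - 1) - (s - 1) ^ (p - 1)
        - (p - 1) * (s - 1) ^ (p - 2) * (t - s)| ≤ C * μ ^ (p - 3) * (t - s) ^ 2 := by
      have h := mul_le_mul_of_nonneg_left (hC a haI b hb2)
        (show 0 ≤ μ ^ (p - 3) * μ ^ 2 by positivity)
      rw [← abs_of_nonneg (show 0 ≤ μ ^ (p - 3) * μ ^ 2 by positivity), ← abs_mul,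
        abs_of_nonneg (show 0 ≤ μ ^ (p - 3) * μ ^ 2 by positivity)] at h
      rw [hx1, hx2, hy, show t - s = μ * (b - a) by rw [ha, hb]; ring]
      rw [show p - 1 - 1 = p - 2 by ring] at h
      calc _ = |μ ^ (p - 3) * μ ^ 2 * ((max b 0) ^ (p - 1) - a ^ (p - 1)
            - (p - 1) * a ^ (p - 2) * (b - a))| := by ring_nf
        _ ≤ _ := h
        _ = _ := by ring
    have hid : t * (hfun p t - hfun p s - hderiv p s * (t - s)) =
        ((max (t - 1) 0) ^ (p - 1) - (s - 1) ^ (p - 1)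
          - (p - 1) * (s - 1) ^ (p - 2) * (t - s))
        - (t - s) ^ 2 * ((p - 1) * (s - 1) ^ (p - 2) / s)
        + (t - s) ^ 2 * ((s - 1) ^ (p - 1) / s ^ 2) := by
      rw [mul_sub, mul_sub, mul_hfun p hp ht0, hderiv_eq p hs, hfun,
        max_eq_left (by linarith : (0 : ℝ) ≤ s - 1)]
      field_simp
      ring
    have h1 := mul_le_mul_of_nonneg_left hD1' (sq_nonneg (t - s))
    have h2 := mul_le_mul_of_nonneg_left hD2' (sq_nonneg (t - s))
    have h3 := mul_nonneg (sq_nonneg (t - s)) hD1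
    have h4 := mul_nonneg (sq_nonneg (t - s)) hD2
    rw [hid]
    rw [abs_le] at hT ⊢
    constructor <;> linarith

/-- The linearization estimate with all norms taken with respect to `γ`. -/
lemma abs_Bform_sub_gInner_Avf_le {n N : ℕ} {p ε μ C C0 C1 : ℝ} (hC : 0 ≤ C) (hC0 : 0 < C0)
    (hμ : 0 < μ) {γ : Matrix (Fin n) (Fin n) ℝ} (hγ : IsElliptic C0 C1 γ)
    (ξ ξ' η : Fin N → Fin n → ℝ) (hs : 1 + μ / 4 ≤ gNorm γ ξ) (ht : gNorm γ ξ' ≤ 1 + 2 * μ)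
    (hH : |hderiv p (gNorm γ ξ)| ≤ C * μ ^ (p - 3))
    (hR : |gNorm γ ξ' * (hfun p (gNorm γ ξ') - hfun p (gNorm γ ξ)
      - hderiv p (gNorm γ ξ) * (gNorm γ ξ' - gNorm γ ξ))| ≤
        C * μ ^ (p - 3) * (gNorm γ ξ' - gNorm γ ξ) ^ 2) :
    |Bform p ε γ ξ (ξ' - ξ) η - gInner γ (Avf p ε γ ξ' - Avf p ε γ ξ) η| ≤
      6 * C * μ ^ (p - 3) * gNorm γ (ξ' - ξ) ^ 2 * gNorm γ η := by
  obtain ⟨w, rfl⟩ : ∃ w, ξ' = ξ + w := ⟨ξ' - ξ, by abel⟩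
  rw [add_sub_cancel_left]
  have hA : gInner γ (Avf p ε γ (ξ + w) - Avf p ε γ ξ) η =
      (hfun p (gNorm γ (ξ + w)) + ε) * gInner γ (ξ + w) η
        - (hfun p (gNorm γ ξ) + ε) * gInner γ ξ η := by
    have h : Avf p ε γ (ξ + w) - Avf p ε γ ξ = (hfun p (gNorm γ (ξ + w)) + ε) • (ξ + w)
        + (-(hfun p (gNorm γ ξ) + ε)) • ξ := by
      ext i α
      simp only [Avf, Pi.sub_apply, Pi.add_apply, Pi.smul_apply, smul_eq_mul]
      ring
    rw [h, gInner_add_left, gInner_smul_left, gInner_smul_left]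
    ring
  rw [Bform_eq p ε hγ.1, hA]
  have hb := abs_gInner_le hC0 hγ (ξ + w) η
  have hk := abs_gInner_le hC0 hγ w η
  have ha := abs_gInner_le hC0 hγ ξ w
  have hc := (le_abs_self _).trans (abs_gInner_le hC0 hγ ξ (ξ + w))
  have hsq : gNorm γ (ξ + w) ^ 2 = gNorm γ ξ ^ 2 + 2 * gInner γ ξ w + gNorm γ w ^ 2 := by
    rw [gNorm_sq hC0 hγ, gNorm_sq hC0 hγ, gNorm_sq hC0 hγ, gInner_add_left,
      gInner_comm hγ.1 ξ (ξ + w), gInner_comm hγ.1 w (ξ + w), gInner_add_left, gInner_add_left,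
      gInner_comm hγ.1 w ξ]
    ring
  have hss : gInner γ ξ (ξ + w) = gNorm γ ξ ^ 2 + gInner γ ξ w := by
    rw [gInner_comm hγ.1, gInner_add_left, gNorm_sq hC0 hγ, gInner_comm hγ.1 w]
  have hadd := gInner_add_left (γ := γ) ξ w η
  have ht0 := gNorm_nonneg (γ := γ) (ξ + w)
  have hd0 := gNorm_nonneg (γ := γ) w
  have hm0 := gNorm_nonneg (γ := γ) η
  generalize gNorm γ (ξ + w) = t at *
  generalize gNorm γ ξ = s at *
  generalize gNorm γ w = d at *
  generalize gNorm γ η = m at *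
  generalize gInner γ (ξ + w) η = b at *
  generalize gInner γ ξ η = e at *
  generalize gInner γ w η = k at *
  generalize gInner γ ξ w = a at *
  generalize hderiv p s = H at *
  have hs0 : 0 < s := by linarith
  have htd : (t - s) ^ 2 ≤ d ^ 2 := by rw [hss] at hc; linarith
  have hP : 0 ≤ C * μ ^ (p - 3) := by positivity
  obtain rfl : e = b - k := by linarith
  have hid : (hfun p s + ε) * k + H / s * (a * (b - k))
      - ((hfun p t + ε) * b - (hfun p s + ε) * (b - k)) =
      -((hfun p t - hfun p s - H * (t - s)) * b)
        - H * ((d ^ 2 - (t - s) ^ 2) / (2 * s)) * b - H * (a / s) * k := by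
    rw [show d ^ 2 = t ^ 2 - s ^ 2 - 2 * a by linarith]
    field_simp
    ring
  have h1 : |(hfun p t - hfun p s - H * (t - s)) * b| ≤ C * μ ^ (p - 3) * d ^ 2 * m := by
    rw [abs_mul]
    rw [abs_mul, abs_of_nonneg ht0] at hR
    calc _ ≤ |hfun p t - hfun p s - H * (t - s)| * (t * m) := by gcongr
      _ = t * |hfun p t - hfun p s - H * (t - s)| * m := by ring
      _ ≤ C * μ ^ (p - 3) * (t - s) ^ 2 * m := by gcongr
      _ ≤ _ := by gcongr
  have h2 : |H * ((d ^ 2 - (t - s) ^ 2) / (2 * s)) * b| ≤ 4 * (C * μ ^ (p - 3) * d ^ 2 * m) := by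
    have hts : t / (2 * s) ≤ 4 := by rw [div_le_iff₀ (by positivity)]; linarith
    rw [abs_mul, abs_mul, abs_of_nonneg (div_nonneg (sub_nonneg.2 htd) (by positivity))]
    calc _ ≤ C * μ ^ (p - 3) * (d ^ 2 / (2 * s)) * (t * m) := by
          gcongr
          linarith [sq_nonneg (t - s)]
      _ = C * μ ^ (p - 3) * d ^ 2 * m * (t / (2 * s)) := by ring
      _ ≤ C * μ ^ (p - 3) * d ^ 2 * m * 4 := by gcongr
      _ = _ := by ring
  have h3 : |H * (a / s) * k| ≤ C * μ ^ (p - 3) * d ^ 2 * m := by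
    have has : |a / s| ≤ d := by
      rw [abs_div, abs_of_pos hs0, div_le_iff₀ hs0]; linarith
    rw [abs_mul, abs_mul]
    calc _ ≤ C * μ ^ (p - 3) * d * (d * m) := by gcongr
      _ = _ := by ring
  rw [hid]
  rw [abs_le] at h1 h2 h3 ⊢
  constructor <;> linarith

/-- Lemma `linearization`. -/
theorem statement16 (p C0 C1 : ℝ) (hp : 1 < p) (hC0 : 0 < C0) (hC01 : C0 ≤ C1) :
    ∃ c : ℝ, 0 < c ∧
      ∀ (n N : ℕ), 1 ≤ n → 1 ≤ N →
        ∀ ε : ℝ, 0 ≤ ε → ε ≤ 1 →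
          ∀ μ : ℝ, 0 < μ →
            ∀ γ : Matrix (Fin n) (Fin n) ℝ, IsElliptic C0 C1 γ →
              ∀ ξ ξ' : Fin N → Fin n → ℝ,
                1 + μ / 4 ≤ gNorm γ ξ → gNorm γ ξ ≤ 1 + 2 * μ → gNorm γ ξ' ≤ 1 + 2 * μ →
                ∀ η : Fin N → Fin n → ℝ,
                  |Bform p ε γ ξ (fun i α => ξ' i α - ξ i α) η -
                      gInner γ (fun i α => Avf p ε γ ξ' i α - Avf p ε γ ξ i α) η| ≤
                    c * μ ^ (p - 3) * eNorm (fun i α => ξ' i α - ξ i α) ^ 2 * eNorm η := by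
  obtain ⟨C, hC, hbound⟩ := exists_hderiv_and_remainder_bound hp
  have hC1 : 0 < C1 := hC0.trans_le hC01
  refine ⟨6 * C * C1 * √C1 + 1, by positivity, ?_⟩
  intro n N _ _ ε _ _ μ hμ γ hγ ξ ξ' hs hs2 ht η
  obtain ⟨hH, hR⟩ := hbound μ _ _ hμ hs hs2 (gNorm_nonneg ξ') ht
  have hw := gNorm_le_sqrt_mul_eNorm hC1.le hγ (ξ' - ξ)
  have hη := gNorm_le_sqrt_mul_eNorm hC1.le hγ η
  have hw2 : gNorm γ (ξ' - ξ) ^ 2 ≤ C1 * eNorm (ξ' - ξ) ^ 2 := by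
    calc _ ≤ (√C1 * eNorm (ξ' - ξ)) ^ 2 := pow_le_pow_left₀ (gNorm_nonneg _) hw 2
      _ = _ := by rw [mul_pow, Real.sq_sqrt hC1.le]
  have he : 0 ≤ eNorm η := Real.sqrt_nonneg _
  change |Bform p ε γ ξ (ξ' - ξ) η - gInner γ (Avf p ε γ ξ' - Avf p ε γ ξ) η| ≤
    (6 * C * C1 * √C1 + 1) * μ ^ (p - 3) * eNorm (ξ' - ξ) ^ 2 * eNorm η
  calc _ ≤ 6 * C * μ ^ (p - 3) * gNorm γ (ξ' - ξ) ^ 2 * gNorm γ η :=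
        abs_Bform_sub_gInner_Avf_le hC hC0 hμ hγ ξ ξ' η hs ht hH hR
    _ ≤ 6 * C * μ ^ (p - 3) * (C1 * eNorm (ξ' - ξ) ^ 2) * (√C1 * eNorm η) := by
      have := gNorm_nonneg (γ := γ) η
      gcongr
    _ = (6 * C * C1 * √C1) * μ ^ (p - 3) * eNorm (ξ' - ξ) ^ 2 * eNorm η := by ring
    _ ≤ _ := by
      gcongr
      linarith
end
end

section
/- Let ε ∈ [0,1], δ ∈ (0,1] and M ≥ 1 + δ. For every (C0,C1)-elliptic symmetric matrix γ and every ξ ∈ ℝ^{nN} with 1 + δ < |ξ|_γ ≤ M, the quadratic form ζ ↦ |ξ|_γ · 𝒞_ε(γ,ξ)(ζ,ζ) on ℝ^n satisfies C0 · min{1, p−1} · δ^{p−1} |ζ|² ≤ |ξ|_γ · 𝒞_ε(γ,ξ)(ζ,ζ) ≤ C1 · [M + p M^p/δ] |ζ|² for all ζ ∈ ℝ^n. -/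
noncomputable section

open Real

/-- Cauchy–Schwarz for a symmetric positive semidefinite quadratic form. -/
theorem sq_bilin_le_mul {n : ℕ} (γ : Matrix (Fin n) (Fin n) ℝ)
    (hsymm : ∀ α β, γ α β = γ β α)
    (hpos : ∀ ζ : Fin n → ℝ, 0 ≤ ∑ α, ∑ β, γ α β * ζ α * ζ β) (x y : Fin n → ℝ) :
    (∑ α, (∑ d, γ α d * x d) * y α) ^ 2 ≤
      (∑ α, ∑ β, γ α β * x α * x β) * ∑ α, ∑ β, γ α β * y α * y β := by
  have hxy : ∑ α, ∑ β, γ α β * y α * x β = ∑ α, (∑ d, γ α d * x d) * y α := by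
    simp only [Finset.sum_mul]
    exact Finset.sum_congr rfl fun α _ => Finset.sum_congr rfl fun β _ => by ring
  have hyx : ∑ α, ∑ β, γ α β * x α * y β = ∑ α, (∑ d, γ α d * x d) * y α := by
    rw [← hxy, Finset.sum_comm]
    exact Finset.sum_congr rfl fun α _ => Finset.sum_congr rfl fun β _ => by
      rw [hsymm β α]; ring
  have hquad : ∀ t : ℝ, 0 ≤ (∑ α, ∑ β, γ α β * x α * x β) * (t * t) +
      (2 * ∑ α, (∑ d, γ α d * x d) * y α) * t + ∑ α, ∑ β, γ α β * y α * y β := by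
    intro t
    have hexp : ∑ α, ∑ β, γ α β * (t * x α + y α) * (t * x β + y β) =
        (t * t) * (∑ α, ∑ β, γ α β * x α * x β) + t * (∑ α, ∑ β, γ α β * x α * y β) +
          t * (∑ α, ∑ β, γ α β * y α * x β) + ∑ α, ∑ β, γ α β * y α * y β := by
      simp only [Finset.mul_sum, ← Finset.sum_add_distrib]
      exact Finset.sum_congr rfl fun α _ => Finset.sum_congr rfl fun β _ => by ring
    have h := hpos fun α => t * x α + y α
    rw [hexp, hxy, hyx] at h
    linarith
  have h := discrim_le_zero hquad
  rw [discrim] at h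
  nlinarith

/-- The quadratic form of `𝒞_ε(γ, ξ)` splits into an isotropic part and a sum of squares. -/
theorem Cform_self {n N : ℕ} (p ε : ℝ) (γ : Matrix (Fin n) (Fin n) ℝ)
    (ξ : Fin N → Fin n → ℝ) (ζ : Fin n → ℝ) :
    Cform p ε γ ξ ζ ζ =
      (hfun p (gNorm γ ξ) + ε) * (∑ α, ∑ β, γ α β * ζ α * ζ β) +
        hderiv p (gNorm γ ξ) / gNorm γ ξ *
          ∑ i, (∑ α, (∑ d, γ α d * ξ i d) * ζ α) ^ 2 := by
  have hS : ∑ i, (∑ α, (∑ d, γ α d * ξ i d) * ζ α) ^ 2 =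
      ∑ α, ∑ β, ∑ i, (∑ d, γ α d * ξ i d) * (∑ k, γ β k * ξ i k) * (ζ α * ζ β) := by
    have hi : ∀ i, (∑ α, (∑ d, γ α d * ξ i d) * ζ α) ^ 2 =
        ∑ α, ∑ β, (∑ d, γ α d * ξ i d) * (∑ k, γ β k * ξ i k) * (ζ α * ζ β) := by
      intro i
      rw [sq, Finset.sum_mul_sum]
      exact Finset.sum_congr rfl fun α _ => Finset.sum_congr rfl fun β _ => by ring
    simp only [hi]
    rw [Finset.sum_comm]
    exact Finset.sum_congr rfl fun α _ => Finset.sum_comm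
  rw [hS, Cform]
  simp only [← Finset.sum_mul]
  rw [Finset.mul_sum, Finset.mul_sum, ← Finset.sum_add_distrib]
  refine Finset.sum_congr rfl fun α _ => ?_
  rw [Finset.mul_sum, Finset.mul_sum, ← Finset.sum_add_distrib]
  exact Finset.sum_congr rfl fun β _ => by ring

/-- An affine function `t ↦ a * q + d * t` on `[0, b * q]` lies between bounds for its endpoint
slopes `a` and `a + d * b`. -/
theorem affine_bounds_of_endpoints {a b d q t l u : ℝ} (hb : 0 < b) (ht : 0 ≤ t)
    (htq : t ≤ b * q) (hla : l ≤ a) (hlb : l ≤ a + d * b) (hau : a ≤ u)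
    (hbu : a + d * b ≤ u) : l * q ≤ a * q + d * t ∧ a * q + d * t ≤ u * q := by
  have key : a * q + d * t = a * (q - t / b) + (a + d * b) * (t / b) := by
    field_simp
    ring
  have h1 : 0 ≤ t / b := by positivity
  have h2 : 0 ≤ q - t / b := by
    rw [sub_nonneg, div_le_iff₀ hb]
    linarith
  rw [key]
  constructor <;> nlinarith [mul_le_mul_of_nonneg_right hla h2,
    mul_le_mul_of_nonneg_right hlb h1, mul_le_mul_of_nonneg_right hau h2,
    mul_le_mul_of_nonneg_right hbu h1]

/-- ellipticity and boundedness of the coefficients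
`A_{αβ} = |ξ|_γ 𝒞_ε(γ,ξ)` (from the proof of Lemma `energyestUe`). -/
theorem statement18 (n N : ℕ) (hn : 1 ≤ n) (hN : 1 ≤ N) (p C0 C1 : ℝ)
    (hp : 1 < p) (hC0 : 0 < C0) (hC01 : C0 ≤ C1)
    (ε δ M : ℝ) (hε0 : 0 ≤ ε) (hε1 : ε ≤ 1) (hδ0 : 0 < δ) (hδ1 : δ ≤ 1)
    (hM : 1 + δ ≤ M)
    (γ : Matrix (Fin n) (Fin n) ℝ) (hγ : IsElliptic C0 C1 γ)
    (ξ : Fin N → Fin n → ℝ) (hξ1 : 1 + δ < gNorm γ ξ) (hξ2 : gNorm γ ξ ≤ M) :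
    ∀ ζ : Fin n → ℝ,
      C0 * min 1 (p - 1) * δ ^ (p - 1) * ∑ α, ζ α ^ 2 ≤
        gNorm γ ξ * Cform p ε γ ξ ζ ζ ∧
      gNorm γ ξ * Cform p ε γ ξ ζ ζ ≤
        C1 * (M + p * M ^ p / δ) * ∑ α, ζ α ^ 2 := by
  intro ζ
  obtain ⟨hsymm, hell⟩ := hγ
  have hpos : ∀ x : Fin n → ℝ, 0 ≤ ∑ α, ∑ β, γ α β * x α * x β := fun x =>
    (mul_nonneg hC0.le (Finset.sum_nonneg fun α _ => sq_nonneg (x α))).trans (hell x).1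
  have hS0 : 0 ≤ ∑ i, (∑ α, (∑ d, γ α d * ξ i d) * ζ α) ^ 2 :=
    Finset.sum_nonneg fun i _ => sq_nonneg _
  have hgg : gNorm γ ξ ^ 2 = ∑ i, ∑ α, ∑ β, γ α β * ξ i α * ξ i β :=
    Real.sq_sqrt (Finset.sum_nonneg fun i _ => hpos (ξ i))
  have hSle : ∑ i, (∑ α, (∑ d, γ α d * ξ i d) * ζ α) ^ 2 ≤
      gNorm γ ξ ^ 2 * ∑ α, ∑ β, γ α β * ζ α * ζ β := by
    rw [hgg, Finset.sum_mul]
    exact Finset.sum_le_sum fun i _ => sq_bilin_le_mul γ hsymm hpos (ξ i) ζ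
  have hQ0 := hpos ζ
  obtain ⟨hQl, hQu⟩ := hell ζ
  rw [Cform_self]
  set s := gNorm γ ξ
  set Q := ∑ α, ∑ β, γ α β * ζ α * ζ β
  set S := ∑ i, (∑ α, (∑ d, γ α d * ξ i d) * ζ α) ^ 2
  have hs0 : 0 < s := by linarith
  have hs1 : 0 < s - 1 := by linarith
  set w := (s - 1) ^ (p - 1) with hw
  have hw0 : 0 < w := Real.rpow_pos_of_pos hs1 _
  have hw2 : (s - 1) ^ (p - 2) = w / (s - 1) := by
    rw [hw, ← Real.rpow_sub_one hs1.ne']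
    congr 1
    ring
  have hh : s * hfun p s = w := by
    rw [hfun, max_eq_left hs1.le, ← hw, mul_div_cancel₀ _ hs0.ne']
  have hd : s * hfun p s + hderiv p s * s ^ 2 = (p - 1) * s * (w / (s - 1)) := by
    rw [hh, hderiv, if_pos (by linarith), hw2]
    field_simp
    ring
  have hsplit : s * ((hfun p s + ε) * Q + hderiv p s / s * S) =
      s * ε * Q + (s * hfun p s * Q + hderiv p s * S) := by
    field_simp
    ring
  have hδw : δ ^ (p - 1) ≤ w := Real.rpow_le_rpow hδ0.le (by linarith) (by linarith)
  have hδp : 0 < δ ^ (p - 1) := Real.rpow_pos_of_pos hδ0 _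
  have hwM : w ≤ M ^ (p - 1) := Real.rpow_le_rpow hs1.le (by linarith) (by linarith)
  have hM0 : 0 < M := by linarith
  have hMp : M ^ p = M ^ (p - 1) * M := by
    rw [← Real.rpow_add_one hM0.ne']
    congr 1
    ring
  have hmin0 : 0 < min 1 (p - 1) := lt_min one_pos (by linarith)
  have hwdiv : w ≤ s * (w / (s - 1)) := by
    rw [← mul_div_assoc, le_div_iff₀ hs1]
    nlinarith
  have hdiv0 : 0 ≤ s * (w / (s - 1)) := by positivity
  have hdivu : s * (w / (s - 1)) ≤ M ^ p / δ := by
    rw [← mul_div_assoc, hMp, mul_comm]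
    exact div_le_div₀ (by positivity) (mul_le_mul hwM hξ2 hs0.le (by positivity)) hδ0
      (by linarith)
  have hla : min 1 (p - 1) * δ ^ (p - 1) ≤ w :=
    (mul_le_mul (min_le_left _ _) hδw hδp.le zero_le_one).trans_eq (one_mul w)
  have hlb : min 1 (p - 1) * δ ^ (p - 1) ≤ (p - 1) * s * (w / (s - 1)) := by
    rw [mul_assoc]
    exact mul_le_mul (min_le_right _ _) (hδw.trans hwdiv) hδp.le (by linarith)
  have hau : w ≤ p * M ^ p / δ := by
    rw [mul_div_assoc]
    nlinarith
  have hbu : (p - 1) * s * (w / (s - 1)) ≤ p * M ^ p / δ := by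
    rw [mul_div_assoc, mul_assoc]
    nlinarith
  obtain ⟨hl, hu⟩ := affine_bounds_of_endpoints (a := s * hfun p s) (d := hderiv p s)
    (sq_pos_of_pos hs0) hS0 hSle (hla.trans_eq hh.symm) (hlb.trans_eq hd.symm)
    (hh.trans_le hau) (hd.trans_le hbu)
  rw [hsplit]
  have hsε : s * ε ≤ M := by nlinarith
  have hεQ : 0 ≤ s * ε * Q := by positivity
  have hεQu : s * ε * Q ≤ M * Q := mul_le_mul_of_nonneg_right hsε hQ0
  constructor
  · have h := mul_le_mul_of_nonneg_left hQl (mul_pos hmin0 hδp).le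
    linarith
  · have h := mul_le_mul_of_nonneg_left hQu
      (add_nonneg hM0.le (hw0.le.trans hau))
    linarith
end
end
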